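/- Let G be a finite strongly connected directed multigraph with Laplacian Δ, and π ∈ ℕ^V with strictly positive entries satisfying Δπ = 0. Then the number of π-Eulerian tours of G starting with a fixed edge e with tail w equals κ_w · Π_{v∈V} (d_v π_v − 1)! / ((π_v!)^{d_v − 1} (π_v − 1)!), where d_v is the outdegree of v and κ_w is the number of spanning trees of G oriented toward w. -/

import Mathlib

open Finset

structure Multigraph (V E : Type) where
  tail : E → V
  head : E → V

namespace Multigraph

variable {V E : Type} [Fintype V] [Fintype E] [DecidableEq V] [DecidableEq E]

/-- Outdegree of a vertex. -/
def outdeg (G : Multigraph V E) (v : V) : ℕ :=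
  (Finset.univ.filter (fun e => G.tail e = v)).card

/-- Indegree of a vertex. -/
def indeg (G : Multigraph V E) (v : V) : ℕ :=
  (Finset.univ.filter (fun e => G.head e = v)).card

/-- Number of edges from `u` to `v`. -/
def edgeCount (G : Multigraph V E) (u v : V) : ℕ :=
  (Finset.univ.filter (fun e => G.tail e = u ∧ G.head e = v)).card

/-- Directed graph Laplacian: `Δ u v = d_v δ_{uv} − d_{vu}`. -/
def laplacian (G : Multigraph V E) : Matrix V V ℤ :=
  fun u v => (if u = v then (G.outdeg v : ℤ) else 0) - (G.edgeCount v u : ℤ)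

def Adj (G : Multigraph V E) (u v : V) : Prop := ∃ e, G.tail e = u ∧ G.head e = v

/-- Strong connectivity: every vertex reaches every other by a directed path. -/
def StronglyConnected (G : Multigraph V E) : Prop :=
  ∀ u v : V, Relation.ReflTransGen G.Adj u v

/-- A list of edges forms a walk: consecutive edges are incident. -/
def IsWalk (G : Multigraph V E) : List E → Prop
  | [] => True
  | [_] => True
  | e :: f :: rest => G.head e = G.tail f ∧ G.IsWalk (f :: rest)

/-- A nonempty walk that returns to its starting vertex. -/
def IsClosedWalk (G : Multigraph V E) (w : List E) : Prop :=
  w ≠ [] ∧ G.IsWalk w ∧ w.getLast?.map G.head = w.head?.map G.tail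

/-- The walk starts at vertex `v`. -/
def StartsAt (G : Multigraph V E) (w : List E) (v : V) : Prop :=
  w.head?.map G.tail = some v

/-- A π-Eulerian tour: closed walk using each edge `e` exactly `π (tail e)` times. -/
def IsPiEulerian (G : Multigraph V E) (π : V → ℕ) (w : List E) : Prop :=
  G.IsClosedWalk w ∧ ∀ e : E, w.count e = π (G.tail e)

/-- An Eulerian tour: closed walk using each edge exactly once. -/
def IsEulerian (G : Multigraph V E) (w : List E) : Prop :=
  G.IsClosedWalk w ∧ ∀ e : E, w.count e = 1

/-- A multi-Eulerian tour: closed walk using each edge at least once, and edges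
with the same tail equally often. -/
def IsMultiEulerian (G : Multigraph V E) (w : List E) : Prop :=
  G.IsClosedWalk w ∧ (∀ e : E, 1 ≤ w.count e) ∧
  ∀ e f : E, G.tail e = G.tail f → w.count e = w.count f

/-- A spanning tree oriented toward `w`: every vertex other than `w` has exactly one
outgoing edge, `w` has none, and every vertex reaches `w` inside the subgraph. -/
def IsTreeTo (G : Multigraph V E) (w : V) (T : Finset E) : Prop :=
  (∀ v, v ≠ w → (T.filter (fun e => G.tail e = v)).card = 1) ∧
  (∀ e ∈ T, G.tail e ≠ w) ∧
  ∀ v : V, Relation.ReflTransGen (fun a b => ∃ e ∈ T, G.tail e = a ∧ G.head e = b) v w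

/-- Number of spanning trees oriented toward `w`. -/
noncomputable def treeCount (G : Multigraph V E) (w : V) : ℕ :=
  Nat.card {T : Finset E // G.IsTreeTo w T}

end Multigraph

section Words

variable {α : Type}

theorem List.length_eq_sum_of_count_eq [Fintype α] [DecidableEq α]
    {l : List α} {c : α → ℕ} (h : ∀ a, l.count a = c a) :
    l.length = ∑ a, c a := by
  rw [← Multiset.coe_card, ← Multiset.sum_count_eq_card (s := univ) (by simp)]
  simp [h]

instance List.finite_count_eq_and [Fintype α] [DecidableEq α] (c : α → ℕ) (p : List α → Prop) :
    Finite {l : List α // (∀ a, l.count a = c a) ∧ p l} :=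
  ((List.finite_length_eq α (∑ a, c a)).subset
    fun _ h => List.length_eq_sum_of_count_eq h.1).to_subtype

theorem List.card_count_eq_head [DecidableEq α] (c : α → ℕ) (a : α) :
    Nat.card {l : List α // (∀ b, l.count b = c b + if a = b then 1 else 0) ∧ l.head? = some a} =
      Nat.card {l : List α // ∀ b, l.count b = c b} := by
  symm
  refine Nat.card_congr (Equiv.ofBijective
    (fun l => ⟨a :: l.1, fun b => by simp [List.count_cons, l.2], rfl⟩) ⟨?_, ?_⟩)
  · intro l l' h
    exact Subtype.ext (List.cons.inj (congrArg Subtype.val h)).2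
  · rintro ⟨_ | ⟨b, l⟩, h, h'⟩
    · simp at h'
    · obtain rfl : b = a := by simpa using h'
      refine ⟨⟨l, fun x => ?_⟩, rfl⟩
      simpa [List.count_cons] using h x

theorem List.card_count_eq_sum_head [Fintype α] [DecidableEq α]
    (c : α → ℕ) (hc : 0 < ∑ a, c a) :
    Nat.card {l : List α // ∀ b, l.count b = c b} =
      ∑ a, Nat.card {l : List α // (∀ b, l.count b = c b) ∧ l.head? = some a} := by
  rw [← Nat.card_sigma]
  symm
  refine Nat.card_congr (Equiv.ofBijective (fun x => ⟨x.2.1, x.2.2.1⟩) ⟨?_, ?_⟩)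
  · rintro ⟨a, l, h, ha⟩ ⟨a', l', h', ha'⟩ hl
    obtain rfl : l = l' := congrArg Subtype.val hl
    obtain rfl : a = a' := by simpa using ha.symm.trans ha'
    rfl
  · rintro ⟨l, h⟩
    have hl := List.length_eq_sum_of_count_eq h
    cases l with
    | nil => simp at hl; omega
    | cons a l => exact ⟨⟨a, a :: l, h, rfl⟩, rfl⟩

theorem List.card_count_eq_head_mul_prod_aux [Fintype α] [DecidableEq α]
    (n : ℕ) (c : α → ℕ) (hc : ∑ a, c a = n + 1)
    (ih : ∀ c : α → ℕ, ∑ a, c a = n →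
      Nat.card {l : List α // ∀ b, l.count b = c b} * ∏ a, (c a).factorial = n.factorial)
    (a : α) :
    Nat.card {l : List α // (∀ b, l.count b = c b) ∧ l.head? = some a} * ∏ b, (c b).factorial =
      c a * n.factorial := by
  rcases Nat.eq_zero_or_pos (c a) with h0 | hpos
  · have : IsEmpty {l : List α // (∀ b, l.count b = c b) ∧ l.head? = some a} := by
      refine ⟨fun ⟨l, h, h'⟩ => ?_⟩
      have := List.count_pos_iff.2 (List.mem_of_mem_head? h')
      rw [h a] at this
      omega
    simp [h0]
  · obtain ⟨c', rfl⟩ : ∃ c' : α → ℕ, c = fun b => c' b + if a = b then 1 else 0 := by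
      refine ⟨fun b => c b - if a = b then 1 else 0, funext fun b => ?_⟩
      dsimp only
      split_ifs with h
      · subst h; omega
      · rfl
    have hprod : ∏ b, (c' b + if a = b then 1 else 0).factorial =
        (c' a + 1) * ∏ b, (c' b).factorial := by
      rw [← Finset.mul_prod_erase univ _ (mem_univ a),
        ← Finset.mul_prod_erase univ (fun b => (c' b).factorial) (mem_univ a), ← mul_assoc]
      congr 1
      · simp [Nat.factorial_succ]
      · refine Finset.prod_congr rfl fun b hb => ?_
        simp [(Finset.ne_of_mem_erase hb).symm]
    have hs : ∑ b, c' b = n := by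
      simpa [Finset.sum_add_distrib] using hc
    rw [List.card_count_eq_head, hprod, ← ih c' hs]
    simp
    ring

theorem List.card_count_eq_mul_prod [Fintype α] [DecidableEq α]
    (n : ℕ) (c : α → ℕ) (hc : ∑ a, c a = n) :
    Nat.card {l : List α // ∀ b, l.count b = c b} * ∏ a, (c a).factorial = n.factorial := by
  induction n generalizing c with
  | zero =>
    have h0 : ∀ a, c a = 0 := by simpa using hc
    have : Unique {l : List α // ∀ b, l.count b = c b} :=
      { default := ⟨[], by simp [h0]⟩
        uniq := fun ⟨l, h⟩ => Subtype.ext <| List.eq_nil_of_length_eq_zero <|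
          (List.length_eq_sum_of_count_eq h).trans hc }
    rw [Nat.card_unique]
    simp [h0]
  | succ n ih =>
    rw [List.card_count_eq_sum_head c (by omega), Finset.sum_mul,
      Finset.sum_congr rfl fun a _ => List.card_count_eq_head_mul_prod_aux n c hc ih a,
      ← Finset.sum_mul, hc, Nat.factorial_succ]

theorem List.card_count_eq_head_mul_prod [Fintype α] [DecidableEq α] (c : α → ℕ) (a : α) :
    Nat.card {l : List α // (∀ b, l.count b = c b) ∧ l.head? = some a} * ∏ b, (c b).factorial =
      c a * (∑ b, c b - 1).factorial := by
  rcases h : ∑ b, c b with _ | n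
  · have h0 : ∀ b, c b = 0 := by simpa using h
    have : IsEmpty {l : List α // (∀ b, l.count b = c b) ∧ l.head? = some a} := by
      refine ⟨fun ⟨l, h, h'⟩ => ?_⟩
      have := List.count_pos_iff.2 (List.mem_of_mem_head? h')
      rw [h a, h0] at this
      omega
    rw [Nat.card_of_isEmpty, h0, zero_mul, zero_mul]
  · exact List.card_count_eq_head_mul_prod_aux n c h (List.card_count_eq_mul_prod n) a

theorem List.card_count_eq_getLast [DecidableEq α] (c : α → ℕ) (a : α) :
    Nat.card {l : List α // (∀ b, l.count b = c b) ∧ l.getLast? = some a} =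
      Nat.card {l : List α // (∀ b, l.count b = c b) ∧ l.head? = some a} := by
  refine Nat.card_congr (Equiv.subtypeEquiv (Function.Involutive.toPerm _ List.reverse_involutive)
    fun l => ?_)
  simp

end Words

namespace Multigraph

variable {V E : Type}

/-- `l` is a walk from `u` to `w`; the empty list is allowed when `u = w`. -/
def IsWalkFromTo (G : Multigraph V E) (w : V) : V → List E → Prop
  | u, [] => u = w
  | u, f :: l => G.tail f = u ∧ G.IsWalkFromTo w (G.head f) l

/-- The relation following the last edge of each word `ρ a`, for `a ≠ w`. -/
def LastExit (G : Multigraph V E) (w : V) (ρ : V → List E) (a b : V) : Prop :=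
  a ≠ w ∧ ∃ t, (ρ a).getLast? = some t ∧ G.head t = b

/-- The words of exits of a list of edges, vertex by vertex. -/
def exits [DecidableEq V] (G : Multigraph V E) (l : List E) (v : V) : List E :=
  l.filter (fun f => G.tail f = v)

theorem isWalk_and_iff_isWalkFromTo (G : Multigraph V E) (u w : V) (l : List E) (hl : l ≠ []) :
    (G.IsWalk l ∧ l.getLast?.map G.head = some w ∧ l.head?.map G.tail = some u) ↔
      G.IsWalkFromTo w u l := by
  induction l generalizing u with
  | nil => exact absurd rfl hl
  | cons f l ih =>
    cases l with
    | nil => simp [IsWalk, IsWalkFromTo, and_comm]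
    | cons g l =>
      rw [IsWalkFromTo, ← ih (G.head f) (by simp)]
      simp [IsWalk, List.getLast?_cons_cons]
      tauto

theorem IsWalkFromTo.reflTransGen_lastExit [DecidableEq V]
    {G : Multigraph V E} {w u : V} {l : List E}
    (h : G.IsWalkFromTo w u l) {v : V} (hv : G.exits l v ≠ []) :
    Relation.ReflTransGen (G.LastExit w (G.exits l)) v w := by
  induction l generalizing u v with
  | nil => simp [exits] at hv
  | cons f l ih =>
    obtain ⟨rfl, hl⟩ := h
    have mono : ∀ a b, G.LastExit w (G.exits l) a b → G.LastExit w (G.exits (f :: l)) a b := by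
      rintro a b ⟨ha, t, ht, hb⟩
      refine ⟨ha, t, ?_, hb⟩
      simp only [exits, List.filter_cons] at ht ⊢
      split_ifs
      · simp [List.getLast?_cons, ht]
      · exact ht
    by_cases hv' : G.exits l v = []
    · have hfv : G.tail f = v := by
        by_contra hne
        exact hv (by simpa [exits, List.filter_cons, hne] using hv')
      subst hfv
      by_cases hw : G.tail f = w
      · rw [hw]
      refine Relation.ReflTransGen.head (b := G.head f) ⟨hw, f, ?_, rfl⟩ ?_
      · rw [exits] at hv'
        simp [exits, hv']
      · cases l with
        | nil => rw [show G.head f = w from hl]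
        | cons g l =>
          refine Relation.ReflTransGen.mono mono _ _ (ih hl ?_)
          simp [exits, hl.1]
    · exact Relation.ReflTransGen.mono mono _ _ (ih hl hv')

theorem IsWalkFromTo.eq_of_exits_eq [DecidableEq V]
    {G : Multigraph V E} {w u : V} {l l' : List E}
    (h : G.IsWalkFromTo w u l) (h' : G.IsWalkFromTo w u l') (he : G.exits l = G.exits l') :
    l = l' := by
  induction l generalizing u l' with
  | nil =>
    cases l' with
    | nil => rfl
    | cons g l' => simpa [exits] using congrFun he (G.tail g)
  | cons f l ih =>
    cases l' with
    | nil => simpa [exits] using congrFun he (G.tail f)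
    | cons g l' =>
      obtain ⟨rfl, hl⟩ := h
      obtain ⟨hg, hl'⟩ := h'
      obtain rfl : f = g := by
        have := congrFun he (G.tail f)
        simp [exits, hg] at this
        exact this.1
      congr 1
      refine ih hl hl' (funext fun v => ?_)
      have := congrFun he v
      simp only [exits, List.filter_cons] at this ⊢
      split_ifs at this
      · exact (List.cons.inj this).2
      · exact this

theorem not_lastExit [Fintype V] [DecidableEq V]
    (G : Multigraph V E) {w : V} {ρ : V → List E} (x : V)
    (hx : ∑ a, (ρ a).countP (fun f => G.head f = x) = 0) (y : V) : ¬ G.LastExit w ρ y x := by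
  rintro ⟨-, t, ht, rfl⟩
  have h0 := (Finset.sum_eq_zero_iff.1 hx) y (mem_univ y)
  rw [List.countP_eq_zero] at h0
  exact h0 t (List.mem_of_getLast? ht) (by simp)

theorem exists_isWalkFromTo_exits_eq [Fintype V] [DecidableEq V]
    (G : Multigraph V E) (w : V) (n : ℕ) (u : V)
    (ρ : V → List E) (hn : ∑ v, (ρ v).length = n)
    (htail : ∀ v, ∀ f ∈ ρ v, G.tail f = v)
    (hbal : ∀ v, (ρ v).length + (if v = w then 1 else 0) =
      ∑ a, (ρ a).countP (fun f => G.head f = v) + (if v = u then 1 else 0))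
    (hreach : ∀ v, ρ v ≠ [] → Relation.ReflTransGen (G.LastExit w ρ) v w) :
    ∃ l, G.IsWalkFromTo w u l ∧ G.exits l = ρ := by
  induction n generalizing u ρ with
  | zero =>
    have h0 : ∀ v, ρ v = [] := by simpa using hn
    refine ⟨[], ?_, funext fun v => by simp [exits, h0]⟩
    have := hbal u
    by_contra hne
    simp [h0, show u ≠ w from hne] at this
  | succ n ih =>
    rcases hu : ρ u with _ | ⟨f, rest⟩
    · have hb := hbal u
      simp only [hu, List.length_nil, if_true] at hb
      have huw : u = w := by
        by_contra hne
        simp [hne] at hb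
      subst huw
      have hin : ∑ a, (ρ a).countP (fun f => G.head f = u) = 0 := by
        simp only [if_true] at hb
        omega
      obtain ⟨v, hv⟩ : ∃ v, ρ v ≠ [] := by
        by_contra! hall
        simp [hall] at hn
      rcases Relation.ReflTransGen.cases_tail (hreach v hv) with h | ⟨y, -, hy⟩
      · exact absurd (h ▸ hu) hv
      · exact absurd hy (G.not_lastExit u hin y)
    · have hf : G.tail f = u := htail u f (by simp [hu])
      set ρ' := Function.update ρ u rest with hρ'
      have hρu : ρ' u = rest := by simp [hρ']
      have hρne : ∀ v, v ≠ u → ρ' v = ρ v := fun v hv => by simp [hρ', hv]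
      have hin : ∀ x, ∑ a, (ρ a).countP (fun g => G.head g = x) =
          ∑ a, (ρ' a).countP (fun g => G.head g = x) + if x = G.head f then 1 else 0 := by
        intro x
        rw [← Finset.add_sum_erase univ _ (mem_univ u),
          ← Finset.add_sum_erase univ (fun a => (ρ' a).countP (fun g => G.head g = x))
            (mem_univ u), hu, hρu,
          Finset.sum_congr rfl fun v hv => by rw [← hρne v (Finset.ne_of_mem_erase hv)]]
        simp only [List.countP_cons, decide_eq_true_eq, eq_comm (a := x)]
        omega
      have hlen : ∀ v, (ρ v).length = (ρ' v).length + if v = u then 1 else 0 := by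
        intro v
        split_ifs with h
        · subst h; simp [hu, hρu]
        · simp [hρne v h]
      have hreach' : ∀ v, ρ' v ≠ [] → Relation.ReflTransGen (G.LastExit w ρ') v w := by
        by_cases hcase : rest = [] ∧ u ≠ w
        · obtain ⟨rfl, huw⟩ := hcase
          have hin0 : ∑ a, (ρ a).countP (fun f => G.head f = u) = 0 := by
            have := hbal u
            simp [hu, huw] at this
            simpa using this
          have key : ∀ x, Relation.ReflTransGen (G.LastExit w ρ) x w → x ≠ u →
              Relation.ReflTransGen (G.LastExit w ρ') x w := by
            intro x hx
            induction hx using Relation.ReflTransGen.head_induction_on with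
            | refl => intro _; exact .refl
            | head hab _ ihb =>
              intro hne
              refine .head (b := _) ?_ (ihb ?_)
              · rwa [LastExit, hρne _ hne]
              · rintro rfl
                exact G.not_lastExit _ hin0 _ hab
          intro v hv
          have hvu : v ≠ u := by
            rintro rfl
            exact hv hρu
          exact key v (hreach v (hρne v hvu ▸ hv)) hvu
        · have mono : ∀ a b, G.LastExit w ρ a b → G.LastExit w ρ' a b := by
            rintro a b ⟨haw, t, ht, hb⟩
            refine ⟨haw, t, ?_, hb⟩
            by_cases hau : a = u
            · subst hau
              have hrest : rest ≠ [] := fun h => hcase ⟨h, haw⟩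
              obtain ⟨g, r, rfl⟩ := List.exists_cons_of_ne_nil hrest
              rw [hu, List.getLast?_cons_cons] at ht
              rw [hρu, ht]
            · rwa [hρne a hau]
          intro v hv
          refine Relation.ReflTransGen.mono mono _ _ (hreach v ?_)
          by_cases hvu : v = u
          · subst hvu; simp [hu]
          · rwa [← hρne v hvu]
      have hn' : ∑ v, (ρ' v).length = n := by
        rw [Finset.sum_congr rfl fun v _ => hlen v, Finset.sum_add_distrib] at hn
        simpa using hn
      have htail' : ∀ v, ∀ g ∈ ρ' v, G.tail g = v := by
        intro v g hg
        by_cases hvu : v = u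
        · subst hvu
          exact htail v g (by rw [hu]; exact List.mem_cons_of_mem _ (hρu ▸ hg))
        · exact htail v g (hρne v hvu ▸ hg)
      have hbal' : ∀ v, (ρ' v).length + (if v = w then 1 else 0) =
          ∑ a, (ρ' a).countP (fun g => G.head g = v) + (if v = G.head f then 1 else 0) := by
        intro v
        have h1 := hbal v
        have h2 := hin v
        have h3 := hlen v
        omega
      obtain ⟨l, hl, hle⟩ := ih (G.head f) ρ' hn' htail' hbal' hreach'
      refine ⟨f :: l, ⟨hf, hl⟩, funext fun v => ?_⟩
      have := congrFun hle v
      simp only [exits, List.filter_cons, hf, decide_eq_true_eq] at this ⊢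
      split_ifs with h
      · subst h; rw [this, hu, hρu]
      · rw [this, hρne v (Ne.symm h)]

/-- Words of exits which use every edge out of `v` exactly `π v` times, start with `e` at the
tail of `e`, and whose last edges elsewhere form a tree. -/
def IsExitFamily [DecidableEq V] [DecidableEq E] (G : Multigraph V E) (π : V → ℕ)
    (e : E) (ρ : V → List E) : Prop :=
  (∀ v f, (ρ v).count f = if G.tail f = v then π v else 0) ∧ (ρ (G.tail e)).head? = some e ∧
    ∀ v, Relation.ReflTransGen (G.LastExit (G.tail e) ρ) v (G.tail e)

theorem StronglyConnected.exists_tail_eq {G : Multigraph V E} (hsc : G.StronglyConnected)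
    (e : E) (v : V) : ∃ f, G.tail f = v := by
  rcases Relation.ReflTransGen.cases_head (hsc v (G.tail e)) with h | ⟨y, ⟨f, hf, -⟩, -⟩
  · exact ⟨e, h.symm⟩
  · exact ⟨f, hf⟩

theorem sum_ite_tail_eq [Fintype E] [DecidableEq V] (G : Multigraph V E) (v : V) (n : ℕ) :
    ∑ f, (if G.tail f = v then n else 0) = G.outdeg v * n := by
  simp [outdeg, Finset.sum_ite]

theorem outdeg_mul_eq_of_laplacian [Fintype V] [Fintype E] [DecidableEq V]
    (G : Multigraph V E) (π : V → ℕ)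
    (hker : G.laplacian.mulVec (fun v => (π v : ℤ)) = 0) (v : V) :
    G.outdeg v * π v = ∑ f, if G.head f = v then π (G.tail f) else 0 := by
  have h := congrFun hker v
  simp only [Matrix.mulVec, dotProduct, laplacian, sub_mul, ite_mul, zero_mul,
    Finset.sum_sub_distrib, Finset.sum_ite_eq, mem_univ, if_true, Pi.zero_apply] at h
  have h2 : ∑ u, G.edgeCount u v * π u = ∑ f, if G.head f = v then π (G.tail f) else 0 := by
    simp only [edgeCount, Finset.card_filter, Finset.sum_mul]
    rw [Finset.sum_comm]
    refine Finset.sum_congr rfl fun f _ => ?_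
    rw [Finset.sum_eq_single (G.tail f)]
    · simp
    · intro b _ hb
      simp [hb.symm]
    · simp
  rw [← h2]
  zify
  linarith

theorem IsPiEulerian.isWalkFromTo [DecidableEq E]
    {G : Multigraph V E} {π : V → ℕ} {e : E} {l : List E}
    (hl : G.IsPiEulerian π l) (he : l.head? = some e) :
    G.IsWalkFromTo (G.tail e) (G.tail e) l := by
  obtain ⟨⟨hne, hw, hc⟩, -⟩ := hl
  rw [← isWalk_and_iff_isWalkFromTo G _ _ l hne]
  simp [hw, hc, he]

theorem IsPiEulerian.isExitFamily [DecidableEq V] [DecidableEq E]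
    {G : Multigraph V E} (hsc : G.StronglyConnected) {π : V → ℕ}
    (hπ : ∀ v, 0 < π v) {e : E} {l : List E} (hl : G.IsPiEulerian π l) (he : l.head? = some e) :
    G.IsExitFamily π e (G.exits l) := by
  have hcount : ∀ v f, (G.exits l v).count f = if G.tail f = v then π v else 0 := by
    intro v f
    split_ifs with h
    · rw [exits, List.count_filter (by simpa using h), hl.2, h]
    · exact List.count_eq_zero.2 fun hf => h (by simpa using (List.mem_filter.1 hf).2)
  refine ⟨hcount, ?_, fun v => (hl.isWalkFromTo he).reflTransGen_lastExit ?_⟩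
  · obtain ⟨l', rfl⟩ : ∃ l', l = e :: l' := by
      cases l with
      | nil => simp at he
      | cons f l => exact ⟨l, by simpa using he⟩
    simp [exits]
  · obtain ⟨f, hf⟩ := hsc.exists_tail_eq e v
    intro h0
    have := hcount v f
    rw [h0, if_pos hf, List.count_nil] at this
    exact (hπ v).ne this

theorem card_tours_eq_card_exitFamilies [Fintype V] [Fintype E] [DecidableEq V] [DecidableEq E]
    (G : Multigraph V E) (hsc : G.StronglyConnected)
    (π : V → ℕ) (hπ : ∀ v, 0 < π v)
    (hker : G.laplacian.mulVec (fun v => (π v : ℤ)) = 0) (e : E) :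
    Nat.card {l : List E // G.IsPiEulerian π l ∧ l.head? = some e} =
      Nat.card {ρ : V → List E // G.IsExitFamily π e ρ} := by
  refine Nat.card_congr (Equiv.ofBijective
    (fun l => ⟨G.exits l.1, l.2.1.isExitFamily hsc hπ l.2.2⟩) ⟨?_, ?_⟩)
  · intro l l' h
    exact Subtype.ext <| IsWalkFromTo.eq_of_exits_eq (l.2.1.isWalkFromTo l.2.2)
      (l'.2.1.isWalkFromTo l'.2.2) (congrArg Subtype.val h)
  · rintro ⟨ρ, hcount, hhead, hreach⟩
    have htail : ∀ v, ∀ f ∈ ρ v, G.tail f = v := by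
      intro v f hf
      by_contra hne
      have := List.count_pos_iff.2 hf
      rw [hcount, if_neg hne] at this
      omega
    obtain ⟨l, hl, rfl⟩ := G.exists_isWalkFromTo_exits_eq (G.tail e) _ (G.tail e) ρ rfl htail
      (fun v => by
        congr 1
        rw [List.length_eq_sum_of_count_eq (hcount v), sum_ite_tail_eq,
          outdeg_mul_eq_of_laplacian G π hker]
        simp only [List.countP_eq_length_filter]
        rw [Finset.sum_congr rfl fun a _ => List.length_eq_sum_of_count_eq
          (c := fun f => if G.head f = v then if G.tail f = a then π a else 0 else 0) ?_,
          Finset.sum_comm]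
        · refine Finset.sum_congr rfl fun f _ => ?_
          split_ifs <;> simp
        · intro f
          split_ifs with h h' <;>
            first
            | rw [List.count_filter (by simpa using h), hcount]; simp [h']
            | exact List.count_eq_zero.2 fun hf => h (by simpa using (List.mem_filter.1 hf).2))
      (fun v _ => hreach v)
    have hle : l.head? = some e := by
      cases l with
      | nil => simp [exits] at hhead
      | cons f l => simpa [exits, hl.1] using hhead
    have hne : l ≠ [] := by
      rintro rfl
      simp at hle
    obtain ⟨h1, h2, h3⟩ := (isWalk_and_iff_isWalkFromTo G _ _ l hne).2 hl
    refine ⟨⟨l, ⟨⟨hne, h1, h2.trans h3.symm⟩, fun f => ?_⟩, hle⟩, rfl⟩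
    have := hcount (G.tail f) f
    rwa [exits, List.count_filter (by simp), if_pos rfl] at this

theorem IsTreeTo.eq_of_mem [DecidableEq V]
    {G : Multigraph V E} {w : V} {T : Finset E} (hT : G.IsTreeTo w T)
    {s t : E} (hs : s ∈ T) (ht : t ∈ T) (h : G.tail s = G.tail t) : s = t :=
  Finset.card_le_one.1 (hT.1 (G.tail t) (hT.2.1 t ht)).le s (by simp [hs, h]) t (by simp [ht])

theorem card_words_eq_div [Fintype E] [DecidableEq V] [DecidableEq E]
    (G : Multigraph V E) (π : V → ℕ) (hπ : ∀ v, 0 < π v) (f : E) :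
    Nat.card {l : List E // (∀ g, l.count g = if G.tail g = G.tail f then π (G.tail f) else 0) ∧
        l.head? = some f} =
      (G.outdeg (G.tail f) * π (G.tail f) - 1).factorial /
        ((π (G.tail f)).factorial ^ (G.outdeg (G.tail f) - 1) *
          (π (G.tail f) - 1).factorial) := by
  have h := List.card_count_eq_head_mul_prod
    (fun g => if G.tail g = G.tail f then π (G.tail f) else 0) f
  have hd : 0 < G.outdeg (G.tail f) := Finset.card_pos.2 ⟨f, by simp⟩
  have hprod : ∏ g, (if G.tail g = G.tail f then π (G.tail f) else 0).factorial =
      (π (G.tail f)).factorial ^ G.outdeg (G.tail f) := by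
    simp [outdeg, Finset.prod_ite, apply_ite Nat.factorial]
  rw [sum_ite_tail_eq, if_pos rfl, hprod] at h
  obtain ⟨d, hd'⟩ := Nat.exists_eq_succ_of_ne_zero hd.ne'
  obtain ⟨p, hp⟩ := Nat.exists_eq_succ_of_ne_zero (hπ (G.tail f)).ne'
  symm
  refine Nat.div_eq_of_eq_mul_left (by positivity) ?_
  refine Nat.eq_of_mul_eq_mul_left (hπ (G.tail f)) (h.symm.trans ?_)
  simp only [hd', hp, Nat.succ_eq_add_one, Nat.add_sub_cancel, pow_succ, Nat.factorial_succ]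
  ring

theorem card_exitFamilies [Fintype V] [Fintype E] [DecidableEq V] [DecidableEq E]
    (G : Multigraph V E) (hsc : G.StronglyConnected)
    (π : V → ℕ) (hπ : ∀ v, 0 < π v) (e : E) :
    Nat.card {ρ : V → List E // G.IsExitFamily π e ρ} =
      G.treeCount (G.tail e) *
        ∏ v : V, (G.outdeg v * π v - 1).factorial /
          ((π v).factorial ^ (G.outdeg v - 1) * (π v - 1).factorial) := by
  classical
  let W (T : Finset E) (v : V) : Type :=
    {l : List E // (∀ f, l.count f = if G.tail f = v then π v else 0) ∧
      if v = G.tail e then l.head? = some e else ∃ t ∈ T, l.getLast? = some t}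
  have hmem : ∀ {T : Finset E} {v : V} (l : W T v), ∀ f ∈ l.1, G.tail f = v := by
    intro T v l f hf
    by_contra hne
    have := List.count_pos_iff.2 hf
    rw [l.2.1, if_neg hne] at this
    omega
  have hW : ∀ T, G.IsTreeTo (G.tail e) T → ∀ v, Nat.card (W T v) =
      (G.outdeg v * π v - 1).factorial /
          ((π v).factorial ^ (G.outdeg v - 1) * (π v - 1).factorial) := by
    intro T hT v
    by_cases hv : v = G.tail e
    · subst hv
      simp only [W, if_true]
      exact G.card_words_eq_div π hπ e
    · obtain ⟨t, ht⟩ := Finset.card_eq_one.1 (hT.1 v hv)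
      obtain ⟨htT, rfl⟩ : t ∈ T ∧ G.tail t = v := by
        have : t ∈ T.filter (fun e => G.tail e = v) := by simp [ht]
        simpa using this
      rw [← G.card_words_eq_div π hπ t, ← List.card_count_eq_getLast]
      refine Nat.card_congr (Equiv.subtypeEquivRight fun l => and_congr_right fun hl => ?_)
      rw [if_neg hv]
      refine ⟨?_, fun h => ⟨t, htT, h⟩⟩
      rintro ⟨s, hs, hls⟩
      rw [hT.eq_of_mem htT hs (hmem (T := T) ⟨l, hl, by rw [if_neg hv]; exact ⟨s, hs, hls⟩⟩ s
        (List.mem_of_getLast? hls)).symm, hls]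
  have hchar : ∀ {T : Finset E} (_ : G.IsTreeTo (G.tail e) T) (r : ∀ v, W T v) (t : E),
      t ∈ T ↔ G.tail t ≠ G.tail e ∧ (r (G.tail t)).1.getLast? = some t := by
    intro T hT r t
    have aux : G.tail t ≠ G.tail e → ∃ s ∈ T, G.tail s = G.tail t ∧
        (r (G.tail t)).1.getLast? = some s := by
      intro h
      have h2 := (r (G.tail t)).2.2
      rw [if_neg h] at h2
      obtain ⟨s, hs, hl⟩ := h2
      exact ⟨s, hs, hmem _ s (List.mem_of_getLast? hl), hl⟩
    constructor
    · intro ht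
      have h := hT.2.1 t ht
      obtain ⟨s, hs, hst, hl⟩ := aux h
      exact ⟨h, by rw [hl, hT.eq_of_mem hs ht hst]⟩
    · rintro ⟨h, hl⟩
      obtain ⟨s, hs, -, hl'⟩ := aux h
      obtain rfl : t = s := by simpa using hl.symm.trans hl'
      exact hs
  have hfam : ∀ {T : Finset E} (_ : G.IsTreeTo (G.tail e) T) (r : ∀ v, W T v),
      G.IsExitFamily π e fun v => (r v).1 := by
    intro T hT r
    refine ⟨fun v => (r v).2.1, ?_, fun v => ?_⟩
    · have := (r (G.tail e)).2.2
      rwa [if_pos rfl] at this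
    · refine Relation.ReflTransGen.mono ?_ _ _ (hT.2.2 v)
      rintro a b ⟨t, ht, rfl, rfl⟩
      have := (hchar hT r t).1 ht
      exact ⟨this.1, t, this.2, rfl⟩
  let Φ : (Σ T : {T : Finset E // G.IsTreeTo (G.tail e) T}, ∀ v, W T.1 v) →
      {ρ : V → List E // G.IsExitFamily π e ρ} := fun x => ⟨fun v => (x.2 v).1, hfam x.1.2 x.2⟩
  have hΦ : Function.Bijective Φ := by
    constructor
    · rintro ⟨⟨T, hT⟩, r⟩ ⟨⟨T', hT'⟩, r'⟩ h
      have hr : ∀ v, (r v).1 = (r' v).1 := congrFun (congrArg Subtype.val h)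
      obtain rfl : T = T' := by
        ext t
        rw [hchar hT r, hchar hT' r', hr]
      obtain rfl : r = r' := funext fun v => Subtype.ext (hr v)
      rfl
    · rintro ⟨ρ, hcount, hhead, hreach⟩
      have htail : ∀ v, ∀ f ∈ ρ v, G.tail f = v := by
        intro v f hf
        by_contra hne
        have := List.count_pos_iff.2 hf
        rw [hcount, if_neg hne] at this
        omega
      let T : Finset E := univ.filter fun t =>
        G.tail t ≠ G.tail e ∧ (ρ (G.tail t)).getLast? = some t
      have hlast : ∀ v, v ≠ G.tail e → ∃ t ∈ T, G.tail t = v ∧ (ρ v).getLast? = some t := by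
        intro v hv
        obtain ⟨f, hf⟩ := hsc.exists_tail_eq e v
        have hne : ρ v ≠ [] := by
          intro h0
          have := hcount v f
          rw [h0, if_pos hf, List.count_nil] at this
          exact (hπ v).ne this
        obtain ⟨t, ht⟩ : ∃ t, (ρ v).getLast? = some t := ⟨_, List.getLast?_eq_some_getLast hne⟩
        have htv := htail v t (List.mem_of_getLast? ht)
        exact ⟨t, by simp [T, htv, hv, ht], htv, ht⟩
      have hT : G.IsTreeTo (G.tail e) T := by
        refine ⟨fun v hv => ?_, fun t ht => (by simpa [T] using ht : _ ∧ _).1, fun v => ?_⟩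
        · obtain ⟨t, ht, htv, hl⟩ := hlast v hv
          refine Finset.card_eq_one.2 ⟨t, ?_⟩
          ext s
          simp only [Finset.mem_filter, Finset.mem_singleton]
          constructor
          · rintro ⟨hs, rfl⟩
            have hs' := (Finset.mem_filter.1 hs).2.2
            simpa using hs'.symm.trans hl
          · rintro rfl
            exact ⟨ht, htv⟩
        · refine Relation.ReflTransGen.mono ?_ _ _ (hreach v)
          rintro a b ⟨ha, t, ht, rfl⟩
          have hta := htail a t (List.mem_of_getLast? ht)
          exact ⟨t, by simp [T, hta, ha, ht], hta, rfl⟩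
      refine ⟨⟨⟨T, hT⟩, fun v => ⟨ρ v, hcount v, ?_⟩⟩, rfl⟩
      split_ifs with h
      · rw [h, hhead]
      · obtain ⟨t, ht, -, hl⟩ := hlast v h
        exact ⟨t, ht, hl⟩
  have : ∀ T v, Finite (W T v) := fun T v => List.finite_count_eq_and _ _
  rw [← Nat.card_congr (Equiv.ofBijective Φ hΦ), Nat.card_sigma]
  simp only [Nat.card_pi]
  rw [Finset.sum_congr rfl fun T _ => Finset.prod_congr rfl fun v _ => hW T.1 T.2 v]
  simp [treeCount, Nat.card_eq_fintype_card]

end Multigraph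

theorem stmt3 {V E : Type} [Fintype V] [Fintype E] [DecidableEq V] [DecidableEq E]
    (G : Multigraph V E) (hsc : G.StronglyConnected)
    (π : V → ℕ) (hπ : ∀ v, 0 < π v)
    (hker : G.laplacian.mulVec (fun v => (π v : ℤ)) = 0) (e : E) :
    Nat.card {l : List E // G.IsPiEulerian π l ∧ l.head? = some e} =
      G.treeCount (G.tail e) *
        ∏ v : V, (G.outdeg v * π v - 1).factorial /
          ((π v).factorial ^ (G.outdeg v - 1) * (π v - 1).factorial) := by
  rw [G.card_tours_eq_card_exitFamilies hsc π hπ hker e, G.card_exitFamilies hsc π hπ e]
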